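/- Let P be a Gibbs random field. Then for each t ∈ ℤ^d there exists a set of boundary conditions Y_t ⊆ X^{ℤ^d∖{t}} with P{ω : the restriction of ω to ℤ^d∖{t} lies in Y_t} = 1 such that for every filtration F': Y_t ⊆ 𝒳_t(F'); for every x ∈ X the function x̄ ↦ g_t^{x̄}(x) (the limit along F', which is independent of F') is quasilocal on Y_t; and g_t^{x̄}(x) > 0 for every x̄ ∈ Y_t and x ∈ X. -/

import Mathlib

open MeasureTheory Filter Topology

noncomputable section

/-- Sites of the lattice `ℤ^d`. -/
abbrev Site (d : ℕ) := Fin d → ℤ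

/-- Configurations on the whole lattice. -/
abbrev Config (d : ℕ) (X : Type*) := Site d → X

variable {d : ℕ} {X : Type*}

/-- The configuration equal to `x` on `V` and to `z` off `V` (the concatenation `xz`). -/
def concat (V : Finset (Site d)) (x z : Config d X) : Config d X :=
  fun t => if t ∈ V then x t else z t

/-- The configuration equal to `u` on `I` and to `y` off `I`. -/
def extCfg (I : Finset (Site d)) (u : {s // s ∈ I} → X) (y : Config d X) : Config d X :=
  fun t => if h : t ∈ I then u ⟨t, h⟩ else y t

/-- The cylinder set determined by the values of `z` on `Λ`. -/
def cyl (Λ : Finset (Site d)) (z : Config d X) : Set (Config d X) :=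
  {ω | ∀ t ∈ Λ, ω t = z t}

/-- Finite-dimensional distribution `P_Λ(z)`. -/
def fdd [MeasurableSpace X] (P : Measure (Config d X)) (Λ : Finset (Site d))
    (z : Config d X) : ℝ :=
  (P (cyl Λ z)).toReal

/-- A positive random field: all finite-dimensional distributions are positive. -/
def IsPositiveRF [MeasurableSpace X] (P : Measure (Config d X)) : Prop :=
  ∀ Λ : Finset (Site d), Λ.Nonempty → ∀ z : Config d X, 0 < fdd P Λ z

/-- Finite-conditional probability `g_V^z(x)` with boundary condition `z` on `Λ`. -/
def gfin [MeasurableSpace X] (P : Measure (Config d X)) (V Λ : Finset (Site d))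
    (x z : Config d X) : ℝ :=
  fdd P (V ∪ Λ) (concat V x z) / fdd P Λ z

/-- A filtration: an increasing sequence of finite subsets of the lattice with union `ℤ^d`. -/
structure Filt (d : ℕ) where
  Λ : ℕ → Finset (Site d)
  mono : Monotone Λ
  covers : ∀ t : Site d, ∃ n, t ∈ Λ n

/-- The set `𝒳_V(F)` of admissible boundary conditions: those `x̄` for which all the limits
`lim_n g_V^{x̄_{Λ_n ∖ V}}(x)` exist. (Only the values of `x̄` off `V` are ever used.) -/
def admissible [MeasurableSpace X] (P : Measure (Config d X)) (V : Finset (Site d))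
    (F : Filt d) : Set (Config d X) :=
  {xb | ∀ x : Config d X, ∃ L : ℝ,
    Tendsto (fun n => gfin P V (F.Λ n \ V) x xb) atTop (𝓝 L)}

/-- The conditional probability `g_V^{x̄}(x)` : the limit of `g_V^{x̄_{Λ_n ∖ V}}(x)`. -/
def gCond [MeasurableSpace X] (P : Measure (Config d X)) (V : Finset (Site d))
    (F : Filt d) (xb x : Config d X) : ℝ :=
  limUnder atTop (fun n => gfin P V (F.Λ n \ V) x xb)

/-- Transition energy `Δ_V^{x̄}(x,u) = ln (g_V^{x̄}(x) / g_V^{x̄}(u))`. -/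
def TE [MeasurableSpace X] (P : Measure (Config d X)) (V : Finset (Site d))
    (F : Filt d) (xb x u : Config d X) : ℝ :=
  Real.log (gCond P V F xb x / gCond P V F xb u)

/-- Quasilocality (on boundary conditions off `V`) of a function `h` on a set `Y` of
boundary conditions. -/
def QuasilocalOn (V : Finset (Site d)) (Y : Set (Config d X)) (h : Config d X → ℝ) : Prop :=
  ∀ ε > 0, ∃ Λε : Finset (Site d), Disjoint Λε V ∧
    ∀ Λ : Finset (Site d), Disjoint Λ V → Λε ⊆ Λ →
      ∀ xb ∈ Y, ∀ yb ∈ Y, (∀ s ∈ Λ, xb s = yb s) → |h xb - h yb| < ε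

/-- `Y` represents a set of boundary conditions on `ℤ^d ∖ {t}`: membership does not depend
on the value at `t`. -/
def IsBCSet (t : Site d) (Y : Set (Config d X)) : Prop :=
  ∀ (ω : Config d X) (a : X), ω ∈ Y → Function.update ω t a ∈ Y

/-- `F` is a determining filtration for `P` with sets `Y t` of admissible boundary conditions:
the one-point finite-conditional probabilities converge, uniformly over `Y t`, to positive
limits, and `P(Y t) = 1`. -/
structure IsDetermining [MeasurableSpace X] (P : Measure (Config d X)) (F : Filt d)
    (Y : Site d → Set (Config d X)) : Prop where
  meas : ∀ t, MeasurableSet (Y t)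
  bc : ∀ t, IsBCSet t (Y t)
  adm : ∀ t, Y t ⊆ admissible P {t} F
  full : ∀ t, P (Y t) = 1
  pos : ∀ t, ∀ xb ∈ Y t, ∀ x : X, 0 < gCond P {t} F xb (fun _ => x)
  unif : ∀ (t : Site d) (x : X), ∀ ε > 0, ∃ N, ∀ n ≥ N, ∀ xb ∈ Y t,
    |gfin P {t} (F.Λ n \ {t}) (fun _ => x) xb - gCond P {t} F xb (fun _ => x)| < ε

/-- The probabilistic (Pr--) definition of a Gibbs random field. -/
def IsGibbsRF [MeasurableSpace X] (P : Measure (Config d X)) : Prop :=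
  IsProbabilityMeasure P ∧ IsPositiveRF P ∧
    ∃ (F : Filt d) (Y : Site d → Set (Config d X)), IsDetermining P F Y

theorem concat_congr {V Λ : Finset (Site d)} {x y z w : Config d X} (hx : ∀ s ∈ V, x s = y s)
    (hz : ∀ s ∈ Λ, z s = w s) : ∀ s ∈ V ∪ Λ, concat V x z s = concat V y w s := by
  intro s hs
  by_cases h : s ∈ V
  · simp [concat, h, hx s h]
  · simp [concat, h, hz s ((Finset.mem_union.1 hs).resolve_left h)]

theorem concat_singleton_update {s t : Site d} (hst : s ≠ t) (x z : Config d X) (a : X) :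
    concat {t} x (Function.update z s a) = Function.update (concat {t} x z) s a := by
  ext r
  rcases eq_or_ne r s with rfl | hr
  · simp [concat, hst]
  · simp [concat, Function.update_of_ne hr]

theorem cyl_congr {Λ : Finset (Site d)} {z w : Config d X} (h : ∀ s ∈ Λ, z s = w s) :
    cyl Λ z = cyl Λ w := by
  ext ω
  exact forall₂_congr fun s hs => by rw [h s hs]

theorem cyl_insert_update {Λ : Finset (Site d)} {s : Site d} (hs : s ∉ Λ) (z : Config d X)
    (a : X) : cyl (insert s Λ) (Function.update z s a) = cyl Λ z ∩ (fun ω => ω s) ⁻¹' {a} := by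
  have hne : ∀ r ∈ Λ, Function.update z s a r = z r := fun r hr =>
    Function.update_of_ne (ne_of_mem_of_not_mem hr hs) _ _
  ext ω
  simp only [cyl, Set.mem_ofPred_eq, Set.mem_inter_iff, Set.mem_preimage, Set.mem_singleton_iff,
    Finset.forall_mem_insert, Function.update_self]
  rw [and_comm]
  exact and_congr_left' (forall₂_congr fun r hr => by rw [hne r hr])

theorem Filt.exists_forall_subset (F : Filt d) (Λ : Finset (Site d)) :
    ∃ N, ∀ n ≥ N, Λ ⊆ F.Λ n := by
  choose k hk using F.covers
  exact ⟨Λ.sup k, fun n hn s hs => F.mono ((Finset.le_sup hs).trans hn) (hk s)⟩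

section Field

variable [MeasurableSpace X]

theorem fdd_congr (P : Measure (Config d X)) {Λ : Finset (Site d)} {z w : Config d X}
    (h : ∀ s ∈ Λ, z s = w s) : fdd P Λ z = fdd P Λ w := by
  rw [fdd, fdd, cyl_congr h]

theorem gfin_congr (P : Measure (Config d X)) {V Λ : Finset (Site d)} {x y z w : Config d X}
    (hx : ∀ s ∈ V, x s = y s) (hz : ∀ s ∈ Λ, z s = w s) : gfin P V Λ x z = gfin P V Λ y w := by
  rw [gfin, gfin, fdd_congr P (concat_congr hx hz), fdd_congr P hz]

theorem IsPositiveRF.fdd_pos {P : Measure (Config d X)} [IsProbabilityMeasure P]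
    (hP : IsPositiveRF P) (Λ : Finset (Site d)) (z : Config d X) : 0 < fdd P Λ z := by
  rcases Λ.eq_empty_or_nonempty with rfl | h
  · simp [fdd, cyl]
  · exact hP Λ h z

/-- A measurable event of full probability meets every cylinder of a positive random field. -/
theorem IsPositiveRF.exists_mem_cyl {P : Measure (Config d X)} [IsProbabilityMeasure P]
    (hP : IsPositiveRF P) {Y : Set (Config d X)} (hY : MeasurableSet Y) (hY1 : P Y = 1)
    (Λ : Finset (Site d)) (z : Config d X) : ∃ y ∈ Y, ∀ s ∈ Λ, y s = z s := by
  by_contra! h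
  have hsub : cyl Λ z ⊆ Yᶜ := fun ω hω hωY => by
    obtain ⟨s, hs, hne⟩ := h ω hωY
    exact hne (hω s hs)
  have h0 : P (cyl Λ z) = 0 :=
    measure_mono_null hsub ((prob_compl_eq_zero_iff hY).2 hY1)
  have hpos := hP.fdd_pos Λ z
  simp [fdd, h0] at hpos

variable [Fintype X] [MeasurableSingletonClass X]

theorem fdd_eq_sum_insert (P : Measure (Config d X)) [IsFiniteMeasure P]
    {Λ : Finset (Site d)} {s : Site d} (hs : s ∉ Λ) (z : Config d X) :
    fdd P Λ z = ∑ a : X, fdd P (insert s Λ) (Function.update z s a) := by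
  have hm : ∀ a : X, MeasurableSet ((fun ω : Config d X => ω s) ⁻¹' {a}) := fun a =>
    measurable_pi_apply s (measurableSet_singleton a)
  have key : P (cyl Λ z) = ∑ a : X, P (cyl Λ z ∩ (fun ω => ω s) ⁻¹' {a}) := by
    have h := sum_measure_preimage_singleton (μ := P.restrict (cyl Λ z)) Finset.univ
      fun a _ => hm a
    rw [Finset.coe_univ, Set.preimage_univ, Measure.restrict_apply_univ] at h
    rw [← h]
    exact Finset.sum_congr rfl fun a _ => by
      rw [Measure.restrict_apply (hm a), Set.inter_comm]
  simp_rw [fdd, cyl_insert_update hs]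
  rw [key, ENNReal.toReal_sum fun a _ => measure_ne_top _ _]

/-- A finite-conditional probability given `Λ` is an average of those given `M ∪ Λ`; this is the
resulting bound on its distance to a constant `c`, with denominators cleared. -/
theorem abs_fdd_concat_sub_le (P : Measure (Config d X)) [IsFiniteMeasure P] {t : Site d}
    {Λ : Finset (Site d)} (x z : Config d X) (c ε : ℝ) (M : Finset (Site d)) (hM : t ∉ M)
    (h : ∀ y : Config d X, (∀ s ∈ Λ, y s = z s) →
      |fdd P ({t} ∪ (M ∪ Λ)) (concat {t} x y) - c * fdd P (M ∪ Λ) y| ≤ ε * fdd P (M ∪ Λ) y) :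
    |fdd P ({t} ∪ Λ) (concat {t} x z) - c * fdd P Λ z| ≤ ε * fdd P Λ z := by
  induction M using Finset.induction_on with
  | empty => simpa using h z fun _ _ => rfl
  | insert s M _ ih =>
    rw [Finset.mem_insert, not_or] at hM
    refine ih hM.2 fun y hy => ?_
    by_cases hs : s ∈ M ∪ Λ
    · have := h y hy
      rwa [Finset.insert_union, Finset.insert_eq_of_mem hs] at this
    · have hs' : s ∉ {t} ∪ (M ∪ Λ) := by simpa [Ne.symm hM.1] using hs
      rw [fdd_eq_sum_insert P hs, fdd_eq_sum_insert P hs', Finset.mul_sum, Finset.mul_sum,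
        ← Finset.sum_sub_distrib]
      refine (Finset.abs_sum_le_sum_abs _ _).trans (Finset.sum_le_sum fun a _ => ?_)
      have := h (Function.update y s a) fun r hr => by
        rw [Function.update_of_ne, hy r hr]
        rintro rfl
        exact hs (Finset.mem_union_right _ hr)
      rwa [Finset.insert_union, Finset.union_insert, concat_singleton_update (Ne.symm hM.1)]
        at this

theorem abs_gfin_sub_le {P : Measure (Config d X)} [IsProbabilityMeasure P]
    (hP : IsPositiveRF P) {t : Site d} {Λ M : Finset (Site d)} (hΛM : Λ ⊆ M) (hM : t ∉ M)
    (x z : Config d X) (c ε : ℝ)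
    (h : ∀ y : Config d X, (∀ s ∈ Λ, y s = z s) → |gfin P {t} M x y - c| ≤ ε) :
    |gfin P {t} Λ x z - c| ≤ ε := by
  have clear : ∀ (Λ : Finset (Site d)) (y : Config d X), |gfin P {t} Λ x y - c| ≤ ε ↔
      |fdd P ({t} ∪ Λ) (concat {t} x y) - c * fdd P Λ y| ≤ ε * fdd P Λ y := by
    intro Λ y
    have hpos := hP.fdd_pos Λ y
    rw [gfin, div_sub' hpos.ne', abs_div, abs_of_pos hpos, div_le_iff₀ hpos, mul_comm c]
  rw [clear]
  refine abs_fdd_concat_sub_le P x z c ε M hM fun y hy => ?_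
  rw [Finset.union_eq_left.2 hΛM, ← clear]
  exact h y hy

/-- For a determining filtration, the finite-conditional probabilities converge along the net of
all finite sets, uniformly over the set of boundary conditions. -/
theorem IsDetermining.exists_forall_abs_gfin_sub_lt {P : Measure (Config d X)}
    [IsProbabilityMeasure P] (hP : IsPositiveRF P) {F : Filt d} {Y : Site d → Set (Config d X)}
    (hF : IsDetermining P F Y) (t : Site d) (x : X) {ε : ℝ} (hε : 0 < ε) :
    ∃ Λ₀ : Finset (Site d), t ∉ Λ₀ ∧ ∀ Λ : Finset (Site d), t ∉ Λ → Λ₀ ⊆ Λ → ∀ xb ∈ Y t,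
      |gfin P {t} Λ (fun _ => x) xb - gCond P {t} F xb (fun _ => x)| < ε := by
  obtain ⟨N, hN⟩ := hF.unif t x (ε / 3) (by positivity)
  refine ⟨F.Λ N \ {t}, by simp, fun Λ ht hsub xb hxb => ?_⟩
  obtain ⟨n, hn⟩ := F.exists_forall_subset Λ
  have hΛM : Λ ⊆ F.Λ (max n N) \ {t} := fun s hs =>
    Finset.mem_sdiff.2 ⟨hn _ (le_max_left _ _) hs, by
      rw [Finset.mem_singleton]; rintro rfl; exact ht hs⟩
  have hle : |gfin P {t} Λ (fun _ => x) xb - gfin P {t} (F.Λ N \ {t}) (fun _ => x) xb|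
      ≤ ε / 3 + ε / 3 := by
    refine abs_gfin_sub_le hP hΛM (by simp) _ _ _ _ fun y hy => ?_
    obtain ⟨w, hw, hwy⟩ :=
      hP.exists_mem_cyl (hF.meas t) (hF.full t) (F.Λ (max n N) \ {t}) y
    rw [← gfin_congr P (fun _ _ => rfl) hwy, ← gfin_congr P (x := fun _ => x) (z := w)
      (fun _ _ => rfl) fun s hs => (hwy s (hΛM (hsub hs))).trans (hy s (hsub hs))]
    have h₁ := hN (max n N) (le_max_right _ _) w hw
    have h₂ := hN N le_rfl w hw
    rw [abs_lt] at h₁ h₂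
    rw [abs_le]
    constructor <;> linarith
  have h := hN N le_rfl xb hxb
  rw [abs_lt] at h ⊢
  rw [abs_le] at hle
  constructor <;> linarith

end Field

/-- Theorem 4 / `crit-Gibbs-1`, converse part. -/
theorem stmt12 [Fintype X] [Nontrivial X] [MeasurableSpace X] [MeasurableSingletonClass X]
    (P : Measure (Config d X)) (hP : IsGibbsRF P) :
    ∀ t : Site d, ∃ Y : Set (Config d X),
      MeasurableSet Y ∧ IsBCSet t Y ∧ P Y = 1 ∧
      ∃ g : Config d X → X → ℝ,
        (∀ F' : Filt d, Y ⊆ admissible P {t} F' ∧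
          ∀ xb ∈ Y, ∀ x : X, gCond P {t} F' xb (fun _ => x) = g xb x) ∧
        (∀ x : X, QuasilocalOn {t} Y (fun xb => g xb x)) ∧
        (∀ xb ∈ Y, ∀ x : X, 0 < g xb x) := by
  obtain ⟨_, hpos, F, Y, hF⟩ := hP
  intro t
  have hlim : ∀ F' : Filt d, ∀ xb ∈ Y t, ∀ x : X,
      Tendsto (fun n => gfin P {t} (F'.Λ n \ {t}) (fun _ => x) xb) atTop
        (𝓝 (gCond P {t} F xb (fun _ => x))) := by
    intro F' xb hxb x
    rw [Metric.tendsto_atTop]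
    intro ε hε
    obtain ⟨Λ₀, ht, h⟩ := hF.exists_forall_abs_gfin_sub_lt hpos t x hε
    obtain ⟨N, hN⟩ := F'.exists_forall_subset Λ₀
    refine ⟨N, fun n hn => h _ (by simp) (fun s hs => ?_) xb hxb⟩
    exact Finset.mem_sdiff.2 ⟨hN n hn hs, by
      rw [Finset.mem_singleton]; rintro rfl; exact ht hs⟩
  refine ⟨Y t, hF.meas t, hF.bc t, hF.full t, fun xb x => gCond P {t} F xb fun _ => x,
    fun F' => ⟨fun xb hxb x => ⟨_, (hlim F' xb hxb (x t)).congr fun n =>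
      gfin_congr P (by simp) fun _ _ => rfl⟩, fun xb hxb x => (hlim F' xb hxb x).limUnder_eq⟩,
    fun x ε hε => ?_, hF.pos t⟩
  obtain ⟨Λ₀, ht, h⟩ := hF.exists_forall_abs_gfin_sub_lt hpos t x (half_pos hε)
  refine ⟨Λ₀, Finset.disjoint_singleton_right.2 ht, fun Λ hΛ hsub xb hxb yb hyb hxy => ?_⟩
  have hΛ' := Finset.disjoint_singleton_right.1 hΛ
  have h₁ := h Λ hΛ' hsub xb hxb
  have h₂ := h Λ hΛ' hsub yb hyb
  rw [gfin_congr P (fun _ _ => rfl) hxy] at h₁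
  rw [abs_lt] at h₁ h₂ ⊢
  constructor <;> linarith
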